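/- In the explicit Latin square X of order 8 given in the context, there are exactly seven intercalates that contain the entry (8,8;8). -/

import Mathlib

/-- A Latin square of order `n`, represented as a function giving the entry in
row `i`, column `j`: every element occurs exactly once in each row and column. -/
def IsLatinSquare {n : ℕ} (L : Fin n → Fin n → Fin n) : Prop :=
  (∀ i, Function.Injective (L i)) ∧ (∀ j, Function.Injective fun i => L i j)

/-- The set of triples `(i, j; L i j)` of a square `L`. -/
def entries {n : ℕ} (L : Fin n → Fin n → Fin n) : Finset (Fin n × Fin n × Fin n) :=
  Finset.univ.image fun p : Fin n × Fin n => (p.1, p.2, L p.1 p.2)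

/-- `T` is a Latin trade in `L`: the (nonempty) set of entries of `L` in the positions
where `L` differs from some other Latin square `L'` of the same order. -/
def IsTrade {n : ℕ} (L : Fin n → Fin n → Fin n)
    (T : Finset (Fin n × Fin n × Fin n)) : Prop :=
  ∃ L' : Fin n → Fin n → Fin n, IsLatinSquare L' ∧ L' ≠ L ∧
    T = (Finset.univ.filter fun p : Fin n × Fin n => L p.1 p.2 ≠ L' p.1 p.2).image
          fun p => (p.1, p.2, L p.1 p.2)

/-- `U` is a uniquely completable set for `L`: `U ⊆ L` and `L` is the only
Latin square of order `n` containing `U`. -/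
def IsUC {n : ℕ} (L : Fin n → Fin n → Fin n)
    (U : Finset (Fin n × Fin n × Fin n)) : Prop :=
  U ⊆ entries L ∧
    ∀ L' : Fin n → Fin n → Fin n, IsLatinSquare L' → U ⊆ entries L' → L' = L

/-- `C` is a critical set of `L`: a uniquely completable set for `L`,
no proper subset of which is uniquely completable. -/
def IsCritical {n : ℕ} (L : Fin n → Fin n → Fin n)
    (C : Finset (Fin n × Fin n × Fin n)) : Prop :=
  IsUC L C ∧ ∀ C' ⊂ C, ¬ IsUC L C'

/-- `scs n`: the smallest size of a critical set in any Latin square of order `n`. -/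
noncomputable def scs (n : ℕ) : ℕ :=
  sInf {s | ∃ (L : Fin n → Fin n → Fin n) (C : Finset (Fin n × Fin n × Fin n)),
    IsLatinSquare L ∧ IsCritical L C ∧ C.card = s}

/-- `R(T)`: the number of distinct rows occurring in `T`. -/
def rowCount {n : ℕ} (T : Finset (Fin n × Fin n × Fin n)) : ℕ :=
  (T.image fun t => t.1).card

/-- `C(T)`: the number of distinct columns occurring in `T`. -/
def colCount {n : ℕ} (T : Finset (Fin n × Fin n × Fin n)) : ℕ :=
  (T.image fun t => t.2.1).card

/-- `E(T)`: the number of distinct elements occurring in `T`. -/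
def elemCount {n : ℕ} (T : Finset (Fin n × Fin n × Fin n)) : ℕ :=
  (T.image fun t => t.2.2).card

/-- The Latin square `X` (0-based encoding of the square with rows
(1,6,3,4,5,2,8,7), (5,7,1,2,3,8,6,4), (4,5,2,8,6,7,3,1), (3,2,8,7,1,6,4,5),
(2,8,4,6,7,1,5,3), (7,4,6,3,8,5,1,2), (8,1,7,5,4,3,2,6), (6,3,5,1,2,4,7,8)). -/
def X : Fin 8 → Fin 8 → Fin 8 :=
  ![![0, 5, 2, 3, 4, 1, 7, 6],
    ![4, 6, 0, 1, 2, 7, 5, 3],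
    ![3, 4, 1, 7, 5, 6, 2, 0],
    ![2, 1, 7, 6, 0, 5, 3, 4],
    ![1, 7, 3, 5, 6, 0, 4, 2],
    ![6, 3, 5, 2, 7, 4, 0, 1],
    ![7, 0, 6, 4, 3, 2, 1, 5],
    ![5, 2, 4, 0, 1, 3, 6, 7]]

/-- The positions in which the squares `L` and `L'` differ. -/
def differences {n : ℕ} (L L' : Fin n → Fin n → Fin n) : Finset (Fin n × Fin n) :=
  Finset.univ.filter fun p => L p.1 p.2 ≠ L' p.1 p.2

/-- The entries of `L` in the intersection of rows `i, i'` and columns `j, j'`. -/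
def subarray {n : ℕ} (L : Fin n → Fin n → Fin n) (i j i' j' : Fin n) :
    Finset (Fin n × Fin n × Fin n) :=
  {(i, j, L i j), (i, j', L i j'), (i', j, L i' j), (i', j', L i' j')}

/-- The square obtained from `L` by exchanging the symbols `L i j` and `L i j'` in the
intersection of rows `i, i'` and columns `j, j'`. -/
def switch {n : ℕ} (L : Fin n → Fin n → Fin n) (i j i' j' : Fin n) :
    Fin n → Fin n → Fin n := fun r c =>
  if (r = i ∨ r = i') ∧ (c = j ∨ c = j') then
    if L r c = L i j then L i j' else L i j
  else L r c

variable {n : ℕ} {L L' : Fin n → Fin n → Fin n}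

theorem mem_differences {r c : Fin n} : (r, c) ∈ differences L L' ↔ L r c ≠ L' r c := by
  simp [differences]

theorem exists_col_of_ne (hL : IsLatinSquare L) (hL' : IsLatinSquare L') {r c : Fin n}
    (h : L r c ≠ L' r c) : ∃ c' ≠ c, L' r c' = L r c ∧ L r c' ≠ L' r c' := by
  obtain ⟨c', hc'⟩ := Finite.surjective_of_injective (hL'.1 r) (L r c)
  have hne : c' ≠ c := by rintro rfl; exact h hc'.symm
  exact ⟨c', hne, hc', fun e => hne (hL.1 r (e.trans hc'))⟩

theorem exists_row_of_ne (hL : IsLatinSquare L) (hL' : IsLatinSquare L') {r c : Fin n}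
    (h : L r c ≠ L' r c) : ∃ r' ≠ r, L' r' c = L r c ∧ L r' c ≠ L' r' c := by
  obtain ⟨r', hr'⟩ := Finite.surjective_of_injective (hL'.2 c) (L r c)
  have hne : r' ≠ r := by rintro rfl; exact h hr'.symm
  exact ⟨r', hne, hr', fun e => hne (hL.2 c (e.trans hr'))⟩

/-- Two Latin squares differing in exactly four positions, one of which is `(i, j)`, differ
in the positions of a subsquare of order two. -/
theorem differences_eq_of_card_eq_four (hL : IsLatinSquare L) (hL' : IsLatinSquare L')
    (hcard : (differences L L').card = 4) {i j : Fin n} (h : L i j ≠ L' i j) :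
    ∃ i' j', i' ≠ i ∧ j' ≠ j ∧ L i' j' = L i j ∧ L i' j = L i j' ∧
      differences L L' = {(i, j), (i, j'), (i', j), (i', j')} := by
  obtain ⟨j', hj', ej', dj'⟩ := exists_col_of_ne hL hL' h
  obtain ⟨i', hi', ei', di'⟩ := exists_row_of_ne hL hL' h
  obtain ⟨k, hk, -, dk⟩ := exists_col_of_ne hL hL' di'
  have hD : differences L L' = {(i, j), (i, j'), (i', j), (i', k)} := by
    symm
    apply Finset.eq_of_subset_of_card_le
    · intro p
      simp only [Finset.mem_insert, Finset.mem_singleton]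
      rintro (rfl | rfl | rfl | rfl) <;> rw [mem_differences] <;> assumption
    · rw [hcard, Finset.card_insert_of_notMem, Finset.card_insert_of_notMem,
        Finset.card_insert_of_notMem, Finset.card_singleton] <;>
        simp [hj'.symm, hi'.symm, hk.symm]
  have key {r c : Fin n} (hrc : L r c ≠ L' r c) :
      (r = i ∧ c = j) ∨ (r = i ∧ c = j') ∨ (r = i' ∧ c = j) ∨ (r = i' ∧ c = k) := by
    simpa [hD] using mem_differences.2 hrc
  obtain ⟨l, hl, -, dl⟩ := exists_row_of_ne hL hL' dj'
  obtain rfl : k = j' := by grind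
  obtain ⟨c, hc, ec, dc⟩ := exists_col_of_ne hL hL' dj'
  obtain ⟨r, hr, er, dr⟩ := exists_row_of_ne hL hL' di'
  obtain ⟨s, hs, es, ds⟩ := exists_row_of_ne hL hL' dk
  obtain rfl : c = j := by grind
  obtain rfl : r = i := by grind
  obtain rfl : s = r := by grind
  exact ⟨i', k, hi', hj', es.symm.trans ej', er.symm.trans ec, hD⟩

theorem switch_isLatinSquare (hL : IsLatinSquare L) {i j i' j' : Fin n} (hi : i' ≠ i)
    (hj : j' ≠ j) (h : L i' j' = L i j) (h' : L i' j = L i j') :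
    IsLatinSquare (switch L i j i' j') := by
  have hrow {r c d} (e : L r c = L r d) : c = d := hL.1 r e
  have hcol {r s c} (e : L r c = L s c) : r = s := hL.2 c e
  constructor
  · intro r c d e
    simp only [switch] at e
    grind
  · intro c r s e
    simp only [switch] at e
    grind

theorem differences_switch (hL : IsLatinSquare L) {i j i' j' : Fin n} (hj : j' ≠ j)
    (h' : L i' j = L i j') :
    differences L (switch L i j i' j') = {(i, j), (i, j'), (i', j), (i', j')} := by
  have hne : L i j' ≠ L i j := fun e => hj (hL.1 i e)
  ext ⟨r, c⟩
  simp only [mem_differences, switch, Finset.mem_insert, Finset.mem_singleton, Prod.mk.injEq]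
  grind

/-- The intercalates through a given entry of a Latin square are its subsquares of order two
through that entry. -/
theorem isTrade_card_four_iff (hL : IsLatinSquare L) {i j : Fin n}
    {T : Finset (Fin n × Fin n × Fin n)} :
    (IsTrade L T ∧ T.card = 4 ∧ (i, j, L i j) ∈ T) ↔
      ∃ i' j', i' ≠ i ∧ j' ≠ j ∧ L i' j' = L i j ∧ L i' j = L i j' ∧
        T = subarray L i j i' j' := by
  have hinj : Function.Injective fun p : Fin n × Fin n => (p.1, p.2, L p.1 p.2) := by
    rintro ⟨a, b⟩ ⟨c, d⟩ e
    simp_all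
  constructor
  · rintro ⟨⟨L', hL', -, rfl⟩, hcard, hmem⟩
    rw [Finset.card_image_of_injective _ hinj] at hcard
    have h : L i j ≠ L' i j := by simpa using hmem
    obtain ⟨i', j', hi, hj, e, e', hD⟩ := differences_eq_of_card_eq_four hL hL' hcard h
    refine ⟨i', j', hi, hj, e, e', ?_⟩
    rw [differences] at hD
    rw [hD]
    simp [subarray, Finset.image_insert]
  · rintro ⟨i', j', hi, hj, e, e', rfl⟩
    have hD := differences_switch (i' := i') hL hj e'
    refine ⟨⟨switch L i j i' j', switch_isLatinSquare hL hi hj e e', fun he => ?_, ?_⟩, ?_, ?_⟩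
    · have : (i, j) ∈ differences L (switch L i j i' j') := by simp [hD]
      rw [mem_differences, he] at this
      exact this rfl
    · rw [differences] at hD
      rw [hD]
      simp [subarray, Finset.image_insert]
    · rw [subarray, Finset.card_insert_of_notMem, Finset.card_insert_of_notMem,
        Finset.card_insert_of_notMem, Finset.card_singleton] <;>
        simp [hi.symm, hj.symm]
    · simp [subarray]

theorem X_isLatinSquare : IsLatinSquare X := by
  unfold IsLatinSquare Function.Injective
  decide +kernel

/-- Exactly seven intercalates of `X` contain the entry `(8,8;8)`
(encoded 0-based as `(7,7,7)`). -/
theorem X_intercalates_through_corner :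
    Nat.card {T : Finset (Fin 8 × Fin 8 × Fin 8) //
      IsTrade X T ∧ T.card = 4 ∧ ((7 : Fin 8), (7 : Fin 8), (7 : Fin 8)) ∈ T} = 7 := by
  have hcorner : X 7 7 = 7 := rfl
  rw [Nat.subtype_card
    ((Finset.univ.filter fun p : Fin 8 × Fin 8 =>
      p.1 ≠ 7 ∧ p.2 ≠ 7 ∧ X p.1 p.2 = X 7 7 ∧ X p.1 7 = X 7 p.2).image
        fun p => subarray X 7 7 p.1 p.2)]
  · decide +kernel
  · intro T
    have := isTrade_card_four_iff X_isLatinSquare (i := 7) (j := 7) (T := T)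
    rw [hcorner] at this
    rw [this]
    simp [hcorner, and_assoc, eq_comm (a := T)]
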